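/- The functions g(τ) and U(τ)² are invariant under Γ₀(10), i.e. g(γτ) = g(τ) and U(γτ)² = U(τ)² for all γ ∈ Γ₀(10) and τ ∈ ℍ. -/

import Mathlib

open Complex

/-- The `q`-Pochhammer infinite product `(a; q)∞ = ∏_{n=0}^∞ (1 - a qⁿ)`. -/
noncomputable def qPoch (a q : ℂ) : ℂ := ∏' n : ℕ, (1 - a * q ^ n)

/-- The nome `q = e^{2πiτ}` of a point `τ` of the upper half-plane. -/
noncomputable def Qc (τ : UpperHalfPlane) : ℂ := Complex.exp (2 * Real.pi * Complex.I * τ)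


/-- `g(τ) = (q²;q²)∞²(q⁵;q⁵)∞⁴ / ((q;q)∞⁴(q¹⁰;q¹⁰)∞²)`, the η-quotient
`η(2τ)²η(5τ)⁴/(η(τ)⁴η(10τ)²)`, with `q = e^{2πiτ}`. -/
noncomputable def gfun (τ : UpperHalfPlane) : ℂ :=
  qPoch (Qc τ ^ 2) (Qc τ ^ 2) ^ 2 * qPoch (Qc τ ^ 5) (Qc τ ^ 5) ^ 4 /
    (qPoch (Qc τ) (Qc τ) ^ 4 * qPoch (Qc τ ^ 10) (Qc τ ^ 10) ^ 2)

/-- `U(τ)² = q·(q;q)∞²(q¹⁰;q¹⁰)∞⁴ / ((q²;q²)∞⁴(q⁵;q⁵)∞²)` with `q = e^{2πiτ}`. -/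
noncomputable def U2fun (τ : UpperHalfPlane) : ℂ :=
  Qc τ * (qPoch (Qc τ) (Qc τ) ^ 2 * qPoch (Qc τ ^ 10) (Qc τ ^ 10) ^ 4) /
    (qPoch (Qc τ ^ 2) (Qc τ ^ 2) ^ 4 * qPoch (Qc τ ^ 5) (Qc τ ^ 5) ^ 2)

/-- Exponent (mod 12) of the multiplier of `η ^ 2`. -/
def psi (a b c d : ℤ) : ℤ :=
  (1 - c ^ 2) * (b * d + 3 * (c - 1) * d + c + 3) + c * (a + d - 3)

/-- The primitive 12th root of unity. -/
noncomputable def zet : ℂ := Complex.exp (2 * Real.pi * Complex.I / 12)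

lemma zet_ne : zet ≠ 0 := Complex.exp_ne_zero _

lemma zet_pow : zet ^ 12 = 1 := by
  unfold zet
  rw [← Complex.exp_nat_mul]
  convert Complex.exp_two_pi_mul_I using 2
  push_cast
  ring

lemma zet_three : zet ^ 3 = I := by
  unfold zet
  rw [← Complex.exp_nat_mul]
  convert Complex.exp_pi_div_two_mul_I using 2
  push_cast
  ring

lemma twelve_dvd (m : ℤ) (h3 : (m : ZMod 3) = 0) (h4 : (m : ZMod 4) = 0) : (12 : ℤ) ∣ m := by
  have h3' := (ZMod.intCast_zmod_eq_zero_iff_dvd m 3).1 h3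
  have h4' := (ZMod.intCast_zmod_eq_zero_iff_dvd m 4).1 h4
  push_cast at h3' h4'
  omega

lemma zet_zpow_eq {m n : ℤ} (h : (12 : ℤ) ∣ m - n) : zet ^ m = zet ^ n := by
  obtain ⟨k, hk⟩ := h
  have : m = n + 12 * k := by omega
  rw [this, zpow_add₀ zet_ne, zpow_mul]
  have h12 : zet ^ (12 : ℤ) = 1 := by exact_mod_cast zet_pow
  rw [h12, one_zpow, mul_one]

lemma psi_T (a b c d : ℤ) (h : a * d - b * c = 1) :
    (12 : ℤ) ∣ psi (a + c) (b + d) c d - (psi a b c d + 1) := by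
  unfold psi
  apply twelve_dvd
  · have h' := congrArg (Int.cast : ℤ → ZMod 3) h
    push_cast at h' ⊢
    generalize (a : ZMod 3) = a at *
    generalize (b : ZMod 3) = b at *
    generalize (c : ZMod 3) = c at *
    generalize (d : ZMod 3) = d at *
    clear h
    revert a b c d
    decide
  · have h' := congrArg (Int.cast : ℤ → ZMod 4) h
    push_cast at h' ⊢
    generalize (a : ZMod 4) = a at *
    generalize (b : ZMod 4) = b at *
    generalize (c : ZMod 4) = c at *
    generalize (d : ZMod 4) = d at *
    clear h
    revert a b c d
    decide +kernel

lemma psi_S (a b c d : ℤ) (h : a * d - b * c = 1) :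
    (12 : ℤ) ∣ psi (-c) (-d) a b - (psi a b c d - 3) := by
  unfold psi
  apply twelve_dvd
  · have h' := congrArg (Int.cast : ℤ → ZMod 3) h
    push_cast at h' ⊢
    generalize (a : ZMod 3) = a at *
    generalize (b : ZMod 3) = b at *
    generalize (c : ZMod 3) = c at *
    generalize (d : ZMod 3) = d at *
    clear h
    revert a b c d
    decide +kernel
  · have h' := congrArg (Int.cast : ℤ → ZMod 4) h
    push_cast at h' ⊢
    generalize (a : ZMod 4) = a at *
    generalize (b : ZMod 4) = b at *
    generalize (c : ZMod 4) = c at *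
    generalize (d : ZMod 4) = d at *
    clear h
    revert a b c d
    decide +kernel

lemma psi_g (a b c d : ℤ) (h : a * d - b * (10 * c) = 1) :
    (12 : ℤ) ∣ (psi a (2 * b) (5 * c) d + 2 * psi a (5 * b) (2 * c) d) -
      (2 * psi a b (10 * c) d + psi a (10 * b) c d) := by
  unfold psi
  apply twelve_dvd
  · have h' := congrArg (Int.cast : ℤ → ZMod 3) h
    push_cast at h' ⊢
    generalize (a : ZMod 3) = a at *
    generalize (b : ZMod 3) = b at *
    generalize (c : ZMod 3) = c at *
    generalize (d : ZMod 3) = d at *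
    clear h
    revert a b c d
    decide +kernel
  · have h' := congrArg (Int.cast : ℤ → ZMod 4) h
    push_cast at h' ⊢
    generalize (a : ZMod 4) = a at *
    generalize (b : ZMod 4) = b at *
    generalize (c : ZMod 4) = c at *
    generalize (d : ZMod 4) = d at *
    clear h
    revert a b c d
    decide +kernel

lemma psi_u (a b c d : ℤ) (h : a * d - b * (10 * c) = 1) :
    (12 : ℤ) ∣ (psi a b (10 * c) d + 2 * psi a (10 * b) c d) -
      (2 * psi a (2 * b) (5 * c) d + psi a (5 * b) (2 * c) d) := by
  unfold psi
  apply twelve_dvd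
  · have h' := congrArg (Int.cast : ℤ → ZMod 3) h
    push_cast at h' ⊢
    generalize (a : ZMod 3) = a at *
    generalize (b : ZMod 3) = b at *
    generalize (c : ZMod 3) = c at *
    generalize (d : ZMod 3) = d at *
    clear h
    revert a b c d
    decide +kernel
  · have h' := congrArg (Int.cast : ℤ → ZMod 4) h
    push_cast at h' ⊢
    generalize (a : ZMod 4) = a at *
    generalize (b : ZMod 4) = b at *
    generalize (c : ZMod 4) = c at *
    generalize (d : ZMod 4) = d at *
    clear h
    revert a b c d
    decide +kernel

lemma csq_sq (z : ℂ) : Complex.sqrt z ^ 2 = z := by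
  by_cases hz : z = 0
  · simp [hz, Complex.sqrt]
  · rw [sqrt_eq_exp hz, ← Complex.exp_nat_mul]
    convert Complex.exp_log hz using 2
    push_cast
    ring

lemma eta_S (z : UpperHalfPlane) :
    ModularForm.eta (-1 / (z : ℂ)) ^ 2 = -I * z * ModularForm.eta z ^ 2 := by
  have h := ModularForm.eta_comp_eq_csqrt_I_inv z.2
  simp only [Function.comp, Pi.smul_apply, Pi.mul_apply, smul_eq_mul] at h
  rw [h, mul_pow, mul_pow, inv_pow, csq_sq, csq_sq, Complex.inv_I]
  ring

lemma eta_T (z : ℂ) :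
    ModularForm.eta (z + 1) ^ 2 = zet * ModularForm.eta z ^ 2 := by
  have hq : ∀ n, ModularForm.eta_q n (z + 1) = ModularForm.eta_q n z := by
    intro n
    rw [ModularForm.eta_q_eq_pow, ModularForm.eta_q_eq_pow, mul_add, Complex.exp_add, mul_one,
      Complex.exp_two_pi_mul_I, mul_one]
  unfold ModularForm.eta
  simp only [hq]
  rw [mul_pow, mul_pow, ← mul_assoc]
  congr 1
  unfold Function.Periodic.qParam zet
  rw [← Complex.exp_nat_mul, ← Complex.exp_nat_mul, ← Complex.exp_add]
  congr 1
  push_cast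
  ring

/-- The transformation law for one matrix. -/
def EtaLaw (γ : Matrix.SpecialLinearGroup (Fin 2) ℤ) : Prop :=
  ∀ τ : UpperHalfPlane, ModularForm.eta ((γ • τ : UpperHalfPlane) : ℂ) ^ 2 =
    zet ^ psi (γ 0 0) (γ 0 1) (γ 1 0) (γ 1 1) * ((γ 1 0 : ℂ) * τ + γ 1 1) * ModularForm.eta τ ^ 2

lemma smul_coe (γ : Matrix.SpecialLinearGroup (Fin 2) ℤ) (τ : UpperHalfPlane) :
    ((γ • τ : UpperHalfPlane) : ℂ) =
      ((γ 0 0 : ℂ) * τ + γ 0 1) / ((γ 1 0 : ℂ) * τ + γ 1 1) := by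
  rw [UpperHalfPlane.specialLinearGroup_apply]
  simp

lemma den_ne (γ : Matrix.SpecialLinearGroup (Fin 2) ℤ) (τ : UpperHalfPlane) :
    ((γ 1 0 : ℂ) * τ + γ 1 1) ≠ 0 := by
  have := UpperHalfPlane.denom_ne_zero (γ : GL (Fin 2) ℝ) τ
  simpa [UpperHalfPlane.denom] using this

lemma det_eq (γ : Matrix.SpecialLinearGroup (Fin 2) ℤ) :
    γ 0 0 * γ 1 1 - γ 0 1 * γ 1 0 = 1 := by
  have := γ.det_coe
  rwa [Matrix.det_fin_two] at this

lemma law_T (γ : Matrix.SpecialLinearGroup (Fin 2) ℤ) :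
    EtaLaw (ModularGroup.T * γ) ↔ EtaLaw γ := by
  unfold EtaLaw
  have e00 : (ModularGroup.T * γ) 0 0 = γ 0 0 + γ 1 0 := by
    rw [Matrix.SpecialLinearGroup.coe_mul, ModularGroup.coe_T]
    simp [Matrix.mul_apply, Fin.sum_univ_two]
  have e01 : (ModularGroup.T * γ) 0 1 = γ 0 1 + γ 1 1 := by
    rw [Matrix.SpecialLinearGroup.coe_mul, ModularGroup.coe_T]
    simp [Matrix.mul_apply, Fin.sum_univ_two]
  have e10 : (ModularGroup.T * γ) 1 0 = γ 1 0 := by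
    rw [Matrix.SpecialLinearGroup.coe_mul, ModularGroup.coe_T]
    simp [Matrix.mul_apply, Fin.sum_univ_two]
  have e11 : (ModularGroup.T * γ) 1 1 = γ 1 1 := by
    rw [Matrix.SpecialLinearGroup.coe_mul, ModularGroup.coe_T]
    simp [Matrix.mul_apply, Fin.sum_univ_two]
  rw [e00, e01, e10, e11, zet_zpow_eq (psi_T _ _ _ _ (det_eq γ)), zpow_add₀ zet_ne, zpow_one]
  refine forall_congr' fun τ => ?_
  have hs : (((ModularGroup.T * γ) • τ : UpperHalfPlane) : ℂ) = (γ • τ : UpperHalfPlane) + 1 := by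
    rw [smul_coe, smul_coe, e00, e01, e10, e11]
    rw [div_add_one (den_ne γ τ)]
    congr 1
    push_cast
    ring
  rw [hs, eta_T]
  constructor
  · intro h
    apply mul_left_cancel₀ zet_ne
    rw [h]; ring
  · intro h
    rw [h]; ring

lemma law_S (γ : Matrix.SpecialLinearGroup (Fin 2) ℤ) :
    EtaLaw (ModularGroup.S * γ) ↔ EtaLaw γ := by
  unfold EtaLaw
  have e00 : (ModularGroup.S * γ) 0 0 = -γ 1 0 := by
    rw [Matrix.SpecialLinearGroup.coe_mul, ModularGroup.coe_S]
    simp [Matrix.mul_apply, Fin.sum_univ_two]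
  have e01 : (ModularGroup.S * γ) 0 1 = -γ 1 1 := by
    rw [Matrix.SpecialLinearGroup.coe_mul, ModularGroup.coe_S]
    simp [Matrix.mul_apply, Fin.sum_univ_two]
  have e10 : (ModularGroup.S * γ) 1 0 = γ 0 0 := by
    rw [Matrix.SpecialLinearGroup.coe_mul, ModularGroup.coe_S]
    simp [Matrix.mul_apply, Fin.sum_univ_two]
  have e11 : (ModularGroup.S * γ) 1 1 = γ 0 1 := by
    rw [Matrix.SpecialLinearGroup.coe_mul, ModularGroup.coe_S]
    simp [Matrix.mul_apply, Fin.sum_univ_two]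
  have z3 : zet ^ (-3 : ℤ) = -I := by
    rw [zpow_neg, show (3 : ℤ) = ((3 : ℕ) : ℤ) from rfl, zpow_natCast, zet_three, Complex.inv_I]
  have hn : ∀ τ : UpperHalfPlane, (γ 0 0 : ℂ) * τ + γ 0 1 ≠ 0 := by
    intro τ
    have := den_ne (ModularGroup.S * γ) τ
    rwa [e10, e11] at this
  rw [e00, e01, e10, e11, zet_zpow_eq (psi_S _ _ _ _ (det_eq γ)), sub_eq_add_neg,
    zpow_add₀ zet_ne, z3]
  refine forall_congr' fun τ => ?_
  have hd := den_ne γ τ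
  have hs : (((ModularGroup.S * γ) • τ : UpperHalfPlane) : ℂ) =
      -1 / ((γ • τ : UpperHalfPlane) : ℂ) := by
    rw [smul_coe, smul_coe, e00, e01, e10, e11]
    have := hn τ
    field_simp
    push_cast
    ring
  have hm : (γ 0 0 : ℂ) * τ + γ 0 1 =
      ((γ • τ : UpperHalfPlane) : ℂ) * ((γ 1 0 : ℂ) * τ + γ 1 1) := by
    rw [smul_coe, div_mul_cancel₀ _ hd]
  have hz : ((γ • τ : UpperHalfPlane) : ℂ) ≠ 0 := UpperHalfPlane.ne_zero _
  rw [hs, eta_S, hm]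
  constructor
  · intro h
    apply mul_left_cancel₀ (mul_ne_zero (neg_ne_zero.2 I_ne_zero) hz)
    rw [h]; ring
  · intro h
    rw [h]; ring

lemma law_all (γ : Matrix.SpecialLinearGroup (Fin 2) ℤ) : EtaLaw γ := by
  have hγ : γ ∈ Subgroup.closure {ModularGroup.S, ModularGroup.T} := by
    rw [SpecialLinearGroup.SL2Z_generators]; trivial
  induction hγ using Subgroup.closure_induction_left with
  | one => intro τ; simp [psi]
  | mul_left x hx y hy ih =>
    rcases hx with rfl | rfl
    · exact (law_S y).2 ih
    · exact (law_T y).2 ih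
  | inv_mul_cancel x hx y hy ih =>
    rcases hx with rfl | rfl
    · rw [← law_S]; simpa using ih
    · rw [← law_T]; simpa using ih

lemma eta_trans (a b c d : ℤ) (h : a * d - b * c = 1) (z : ℂ) (hz : 0 < z.im) :
    ModularForm.eta ((a * z + b) / (c * z + d)) ^ 2 =
      zet ^ psi a b c d * (c * z + d) * ModularForm.eta z ^ 2 := by
  let γ : Matrix.SpecialLinearGroup (Fin 2) ℤ :=
    ⟨!![a, b; c, d], by rw [Matrix.det_fin_two_of, h]⟩
  have := law_all γ ⟨z, hz⟩
  rw [smul_coe γ] at this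
  simpa [γ] using this

lemma eta_level (n : ℕ) (hn : 0 < n) (a b c d : ℤ) (h : a * d - b * (n * c) = 1) (z : ℂ)
    (hz : 0 < z.im) :
    ModularForm.eta (n * ((a * z + b) / (((n * c : ℤ) : ℂ) * z + d))) ^ 2 =
      zet ^ psi a (n * b) c d * (((n * c : ℤ) : ℂ) * z + d) * ModularForm.eta (n * z) ^ 2 := by
  have := eta_trans a (n * b) c d (by linarith) (n * z) (by simpa using mul_pos (Nat.cast_pos.2 hn) hz)
  convert this using 2
  · congr 1
    push_cast
    rw [show (c : ℂ) * (n * z) = n * c * z by ring]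
    ring
  · push_cast
    ring

lemma eta_eq_poch (n : ℕ) (τ : UpperHalfPlane) :
    ModularForm.eta (n * (τ : ℂ)) =
      Complex.exp (2 * Real.pi * I * τ / 24) ^ n * qPoch (Qc τ ^ n) (Qc τ ^ n) := by
  unfold ModularForm.eta qPoch Qc Function.Periodic.qParam
  congr 1
  · rw [← Complex.exp_nat_mul]
    congr 1
    push_cast
    ring
  · apply tprod_congr
    intro k
    rw [ModularForm.eta_q_eq_pow, ← Complex.exp_nat_mul (2 * Real.pi * I * τ) n, ← pow_succ']
    congr 3
    ring

lemma g_eta (τ : UpperHalfPlane) : gfun τ =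
    (ModularForm.eta ((2 : ℕ) * (τ : ℂ)) ^ 2) * (ModularForm.eta ((5 : ℕ) * (τ : ℂ)) ^ 2) ^ 2 /
    ((ModularForm.eta ((1 : ℕ) * (τ : ℂ)) ^ 2) ^ 2 * ModularForm.eta ((10 : ℕ) * (τ : ℂ)) ^ 2) := by
  simp only [eta_eq_poch, gfun, pow_one]
  have he : Complex.exp (2 * Real.pi * I * τ / 24) ≠ 0 := Complex.exp_ne_zero _
  generalize Complex.exp (2 * Real.pi * I * τ / 24) = e at *
  rw [← mul_div_mul_left _ _ (pow_ne_zero 24 he)]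
  congr 1 <;> ring

lemma u_eta (τ : UpperHalfPlane) : U2fun τ =
    (ModularForm.eta ((1 : ℕ) * (τ : ℂ)) ^ 2) * (ModularForm.eta ((10 : ℕ) * (τ : ℂ)) ^ 2) ^ 2 /
    ((ModularForm.eta ((2 : ℕ) * (τ : ℂ)) ^ 2) ^ 2 * ModularForm.eta ((5 : ℕ) * (τ : ℂ)) ^ 2) := by
  have hq : Qc τ = Complex.exp (2 * Real.pi * I * τ / 24) ^ 24 := by
    unfold Qc
    rw [← Complex.exp_nat_mul]
    congr 1
    push_cast
    ring
  simp only [eta_eq_poch, U2fun, pow_one]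
  generalize qPoch (Qc τ) (Qc τ) = p1
  generalize qPoch (Qc τ ^ 2) (Qc τ ^ 2) = p2
  generalize qPoch (Qc τ ^ 5) (Qc τ ^ 5) = p5
  generalize qPoch (Qc τ ^ 10) (Qc τ ^ 10) = p10
  rw [hq]
  have he : Complex.exp (2 * Real.pi * I * τ / 24) ≠ 0 := Complex.exp_ne_zero _
  generalize Complex.exp (2 * Real.pi * I * τ / 24) = e at *
  rw [← mul_div_mul_left _ _ (pow_ne_zero 18 he)]
  congr 1 <;> ring

lemma zet_mul {m n k l : ℤ} (h : (12 : ℤ) ∣ (m + 2 * n) - (2 * k + l)) :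
    zet ^ m * (zet ^ n) ^ 2 = (zet ^ k) ^ 2 * zet ^ l := by
  have := zet_zpow_eq h
  rw [zpow_add₀ zet_ne, zpow_add₀ zet_ne, two_mul, two_mul, zpow_add₀ zet_ne,
    zpow_add₀ zet_ne] at this
  rw [pow_two, pow_two, this]

lemma quot_aux (x1 x2 x3 x4 j A B C D : ℂ) (hj : j ≠ 0) (h1 : x3 ≠ 0) (h2 : x4 ≠ 0)
    (h : x1 * x2 ^ 2 = x3 ^ 2 * x4) :
    (x1 * j * A) * (x2 * j * B) ^ 2 / ((x3 * j * C) ^ 2 * (x4 * j * D)) =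
      A * B ^ 2 / (C ^ 2 * D) := by
  have hk : x3 ^ 2 * x4 * j ^ 3 ≠ 0 :=
    mul_ne_zero (mul_ne_zero (pow_ne_zero _ h1) h2) (pow_ne_zero _ hj)
  rw [← mul_div_mul_left (A * B ^ 2) _ hk]
  congr 1
  · rw [← h]; ring
  · ring

/-- The functions `g(τ)` and `U(τ)²` are invariant under `Γ₀(10)`. -/
theorem statement6 (γ : CongruenceSubgroup.Gamma0 10) (τ : UpperHalfPlane) :
    gfun ((γ : Matrix.SpecialLinearGroup (Fin 2) ℤ) • τ) = gfun τ ∧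
    U2fun ((γ : Matrix.SpecialLinearGroup (Fin 2) ℤ) • τ) = U2fun τ := by
  obtain ⟨γ, hγ⟩ := γ
  rw [CongruenceSubgroup.Gamma0_mem] at hγ
  have hdvd := (ZMod.intCast_zmod_eq_zero_iff_dvd _ 10).1 hγ
  obtain ⟨c, hc⟩ := hdvd
  push_cast at hc
  have hdet := det_eq γ
  have hj := den_ne γ τ
  have hs := smul_coe γ τ
  simp only
  rw [g_eta, g_eta, u_eta, u_eta, hs]
  rw [hc] at hdet hj ⊢
  generalize γ 0 0 = a at *
  generalize γ 0 1 = b at *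
  generalize γ 1 1 = d at *
  have hz : 0 < (τ : ℂ).im := τ.2
  have E1 := eta_level 1 (by norm_num) a b (10 * c) d (by push_cast; linarith) τ hz
  have E2 := eta_level 2 (by norm_num) a b (5 * c) d (by push_cast; linarith) τ hz
  have E5 := eta_level 5 (by norm_num) a b (2 * c) d (by push_cast; linarith) τ hz
  have E10 := eta_level 10 (by norm_num) a b c d (by push_cast; linarith) τ hz
  rw [show ((1 : ℕ) : ℤ) * (10 * c) = 10 * c by push_cast; ring,
    show ((1 : ℕ) : ℤ) * b = b by push_cast; ring] at E1
  rw [show ((2 : ℕ) : ℤ) * (5 * c) = 10 * c by push_cast; ring] at E2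
  rw [show ((5 : ℕ) : ℤ) * (2 * c) = 10 * c by push_cast; ring] at E5
  rw [show ((10 : ℕ) : ℤ) * c = 10 * c by push_cast; ring] at E10
  rw [E1, E2, E5, E10]
  constructor
  · exact quot_aux _ _ _ _ _ _ _ _ _ hj (zpow_ne_zero _ zet_ne) (zpow_ne_zero _ zet_ne)
      (zet_mul (psi_g a b c d hdet))
  · exact quot_aux _ _ _ _ _ _ _ _ _ hj (zpow_ne_zero _ zet_ne) (zpow_ne_zero _ zet_ne)
      (zet_mul (psi_u a b c d hdet))
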